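/- Let G be a finite directed acyclic graph on node set Fin n, each node i carrying a random variable X_i valued in a finite set, and let P be a joint probability distribution on the product of these sets with full support. Then P satisfies the causal Markov condition with respect to G — i.e., for every node i, X_i is conditionally independent of its non-descendants Nd(i) given its parents Pa(i), meaning P(x_i | x_{Nd(i)}, x_{Pa(i)}) = P(x_i | x_{Pa(i)}) for all value assignments — if and only if P factorizes as P(x_1, …, x_n) = Π_{i} P(x_i | x_{Pa(i)}), where P(x_i | x_{Pa(i)}) denotes the conditional distribution of X_i given the values of its parent variables. -/

import Mathlib

open Finset in
/-- Induction along ancestral sets of a finite acyclic graph: a property that passes from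
`insert i A` to `A` whenever `A` is ancestral and contains all parents of `i ∉ A` passes from the
full vertex set to every ancestral set. -/
theorem ancestral_downward_induction {α : Type*} [Fintype α] [DecidableEq α] {E : α → α → Prop}
    (hacyclic : ∀ i, ¬ Relation.TransGen E i i) {R : Finset α → Prop} (huniv : R univ)
    (hstep : ∀ (A : Finset α) (i : α), (∀ j ∈ A, ∀ k, E k j → k ∈ A) → i ∉ A →
      (∀ k, E k i → k ∈ A) → R (insert i A) → R A)
    (A : Finset α) (hA : ∀ j ∈ A, ∀ k, E k j → k ∈ A) : R A := by
  induction hm : (Aᶜ).card generalizing A with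
  | zero =>
    rw [card_eq_zero, compl_eq_empty_iff] at hm
    exact hm ▸ huniv
  | succ m ih =>
    have : Std.Irrefl (Relation.TransGen E) := ⟨hacyclic⟩
    have hne : ((Aᶜ : Finset α) : Set α).Nonempty := by
      rw [coe_nonempty, ← card_pos]
      omega
    obtain ⟨i, hiA, hmin⟩ :=
      (Finite.wellFounded_of_trans_of_irrefl (Relation.TransGen E)).has_min _ hne
    have hi : i ∉ A := by simpa using hiA
    have hpa : ∀ k, E k i → k ∈ A := fun k hk => by
      by_contra hkA
      exact hmin k (by simpa using hkA) (.single hk)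
    refine hstep A i hA hi hpa (ih _ ?_ ?_)
    · intro j hj k hk
      rcases mem_insert.1 hj with rfl | hj
      · exact mem_insert_of_mem (hpa k hk)
      · exact mem_insert_of_mem (hA j hj k hk)
    · have := card_compl_add_card A
      have := card_compl_add_card (insert i A)
      rw [card_insert_of_notMem hi] at this
      omega

section Marginal

variable {ι : Type*} [Fintype ι] [DecidableEq ι] {V : ι → Type*} [∀ i, Fintype (V i)]
  [∀ i, DecidableEq (V i)]

/-- The mass that `P` gives to the assignments agreeing with `x` on `S`. -/
def marginalMass (P : (∀ i, V i) → ℝ) (S : Finset ι) (x : ∀ i, V i) : ℝ :=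
  ∑ y : ∀ i, V i, if ∀ j ∈ S, y j = x j then P y else 0

theorem marginalMass_congr (P : (∀ i, V i) → ℝ) {S : Finset ι} {x x' : ∀ i, V i}
    (h : ∀ j ∈ S, x j = x' j) : marginalMass P S x = marginalMass P S x' := by
  unfold marginalMass
  refine Finset.sum_congr rfl fun y _ => if_congr ?_ rfl rfl
  exact forall₂_congr fun j hj => by rw [h j hj]

theorem marginalMass_update (P : (∀ i, V i) → ℝ) {S : Finset ι} {i : ι} (hi : i ∉ S)
    (x : ∀ i, V i) (v : V i) :
    marginalMass P S (Function.update x i v) = marginalMass P S x :=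
  marginalMass_congr P fun _ hj => Function.update_of_ne (ne_of_mem_of_not_mem hj hi) _ _

theorem marginalMass_pos {P : (∀ i, V i) → ℝ} (hP : ∀ x, 0 < P x) (S : Finset ι)
    (x : ∀ i, V i) : 0 < marginalMass P S x := by
  refine Finset.sum_pos' (fun y _ => ?_) ⟨x, Finset.mem_univ x, by simpa using hP x⟩
  split_ifs
  exacts [(hP y).le, le_rfl]

theorem marginalMass_univ (P : (∀ i, V i) → ℝ) (x : ∀ i, V i) :
    marginalMass P Finset.univ x = P x := by
  simp [marginalMass, ← funext_iff]

theorem marginalMass_empty (P : (∀ i, V i) → ℝ) (x : ∀ i, V i) :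
    marginalMass P ∅ x = ∑ y, P y := by
  simp [marginalMass]

theorem sum_marginalMass_insert (P : (∀ i, V i) → ℝ) {S : Finset ι} {i : ι} (hi : i ∉ S)
    (x : ∀ i, V i) :
    ∑ v, marginalMass P (insert i S) (Function.update x i v) = marginalMass P S x := by
  unfold marginalMass
  rw [Finset.sum_comm]
  refine Finset.sum_congr rfl fun y _ => ?_
  have key : ∀ v, (∀ j ∈ insert i S, y j = Function.update x i v j) ↔
      v = y i ∧ ∀ j ∈ S, y j = x j := fun v => by
    rw [Finset.forall_mem_insert, Function.update_self, eq_comm]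
    refine and_congr_right fun _ => forall₂_congr fun j hj => ?_
    rw [Function.update_of_ne (ne_of_mem_of_not_mem hj hi)]
  simp only [key, ite_and]
  simp

/-- The conditional probability of the value of `X i` given the values of `X j`, `j ∈ S`. -/
noncomputable def condMass (P : (∀ i, V i) → ℝ) (i : ι) (S : Finset ι) (x : ∀ i, V i) : ℝ :=
  marginalMass P (insert i S) x / marginalMass P S x

theorem condMass_update (P : (∀ i, V i) → ℝ) {S : Finset ι} {i j : ι} (hj : j ∉ insert i S)
    (x : ∀ i, V i) (v : V j) :
    condMass P i S (Function.update x j v) = condMass P i S x := by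
  rw [condMass, condMass, marginalMass_update P hj,
    marginalMass_update P fun h => hj (Finset.mem_insert_of_mem h)]

theorem sum_condMass {P : (∀ i, V i) → ℝ} (hP : ∀ x, 0 < P x) {S : Finset ι} {i : ι}
    (hi : i ∉ S) (x : ∀ i, V i) : ∑ v, condMass P i S (Function.update x i v) = 1 := by
  simp only [condMass, marginalMass_update P hi]
  rw [← Finset.sum_div, sum_marginalMass_insert P hi, div_self (marginalMass_pos hP S x).ne']

/-- If `X i` is independent of the variables in `B ∪ D` given those in `S`, and `D` is disjoint
from `insert i S`, then it is independent of the variables in `B` given those in `S`. -/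
theorem marginalMass_insert_of_union {P : (∀ i, V i) → ℝ} {S B : Finset ι} {i : ι}
    (D : Finset ι) (hD : Disjoint D (insert i S)) (hDB : Disjoint D B)
    (h : ∀ x, marginalMass P (insert i (B ∪ D)) x
      = condMass P i S x * marginalMass P (B ∪ D) x) (x : ∀ i, V i) :
    marginalMass P (insert i B) x = condMass P i S x * marginalMass P B x := by
  induction D using Finset.induction_on generalizing x with
  | empty => simpa using h x
  | insert j D hjD ih =>
    rw [Finset.disjoint_insert_left] at hD hDB
    refine ih hD.2 hDB.2 (fun z => ?_) x
    have hj : j ∉ B ∪ D := by simp [hDB.1, hjD]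
    have hji : j ≠ i := fun h => hD.1 (h ▸ Finset.mem_insert_self _ _)
    have hj' : j ∉ insert i (B ∪ D) := by simp [hji, hDB.1, hjD]
    rw [← sum_marginalMass_insert P hj', ← sum_marginalMass_insert P hj, Finset.mul_sum]
    refine Finset.sum_congr rfl fun v _ => ?_
    rw [Finset.insert_comm, ← Finset.union_insert, h, condMass_update P hD.1]

end Marginal

/-- Equivalence of the causal Markov condition and the
factorization of the joint distribution for a finite DAG on `Fin n`.

`E j i` means there is a directed edge `j → i`; acyclicity says no node has a
directed path to itself.  `Pa i` is the set of parents of `i`, and `Nd i` the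
set of non-descendants of `i` (nodes `j ≠ i` not reachable from `i` by a
directed path).  `marginal S x` is the marginal probability that the variables
in `S` take the values prescribed by `x`, so that (by full support) the
conditional `P(x_i | x_S) = marginal (insert i S) x / marginal S x`.

The causal Markov condition — for every node `i`,
`P(x_i | x_{Nd(i)}, x_{Pa(i)}) = P(x_i | x_{Pa(i)})` for all assignments —
holds iff `P` factorizes as `P(x) = ∏ i, P(x_i | x_{Pa(i)})`. -/
theorem causal_markov_iff_factorization
    {n : ℕ} (E : Fin n → Fin n → Prop)
    (hacyclic : ∀ i, ¬ Relation.TransGen E i i)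
    (V : Fin n → Type*) [∀ i, Fintype (V i)] [∀ i, DecidableEq (V i)]
    (P : (∀ i, V i) → ℝ)
    (hfull : ∀ x, 0 < P x)
    (hsum : ∑ x, P x = 1)
    (Pa : Fin n → Finset (Fin n))
    (hPa : ∀ i j, j ∈ Pa i ↔ E j i)
    (Nd : Fin n → Finset (Fin n))
    (hNd : ∀ i j, j ∈ Nd i ↔ j ≠ i ∧ ¬ Relation.TransGen E i j)
    (marginal : Finset (Fin n) → (∀ i, V i) → ℝ)
    (hmarginal : ∀ S x,
      marginal S x = ∑ y : ∀ i, V i, if ∀ j ∈ S, y j = x j then P y else 0) :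
    (∀ (i : Fin n) (x : ∀ i, V i),
        marginal (insert i (Nd i ∪ Pa i)) x / marginal (Nd i ∪ Pa i) x
          = marginal (insert i (Pa i)) x / marginal (Pa i) x)
      ↔
    (∀ x : ∀ i, V i,
        P x = ∏ i, marginal (insert i (Pa i)) x / marginal (Pa i) x) := by
  obtain rfl : marginal = marginalMass P := by
    funext S x
    rw [hmarginal, marginalMass]
    congr!
  change (∀ i x, condMass P i (Nd i ∪ Pa i) x = condMass P i (Pa i) x) ↔
    ∀ x, P x = ∏ i, condMass P i (Pa i) x
  have hPaNd : ∀ i, Pa i ⊆ Nd i := fun i j hj => by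
    rw [hPa] at hj
    refine (hNd i j).2 ⟨?_, fun h => hacyclic i (h.tail hj)⟩
    rintro rfl
    exact hacyclic j (.single hj)
  have hunion : ∀ i, Nd i ∪ Pa i = Nd i := fun i => Finset.union_eq_left.2 (hPaNd i)
  have hiNd : ∀ i, i ∉ Nd i := fun i h => ((hNd i i).1 h).1 rfl
  simp only [hunion]
  constructor
  · intro hmarkov x
    by_contra hx
    have hcontra := ancestral_downward_induction hacyclic
      (R := fun A => ¬ ∀ x, marginalMass P A x = ∏ j ∈ A, condMass P j (Pa j) x)
      (fun h => hx (by rw [← h x, marginalMass_univ])) ?_ ∅ (by simp)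
    · exact hcontra fun x => by simp [marginalMass_empty, hsum]
    · intro A i hA hi hpa hins hQ
      refine hins fun z => ?_
      have hANd : A ⊆ Nd i := fun j hj => by
        refine (hNd i j).2 ⟨fun h => hi (h ▸ hj), fun h => hi ?_⟩
        clear hins hpa hi hQ
        induction h using Relation.TransGen.head_induction_on with
        | single h => exact hA _ hj _ h
        | head h _ ih => exact hA _ ih _ h
      have hPaA : Pa i ⊆ A := fun k hk => hpa k ((hPa i k).1 hk)
      rw [Finset.prod_insert hi, ← hQ z]
      refine marginalMass_insert_of_union (Nd i \ A) ?_ Finset.sdiff_disjoint (fun y => ?_) z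
      · rw [Finset.disjoint_insert_right]
        exact ⟨fun h => hiNd i (Finset.mem_sdiff.1 h).1,
          Finset.sdiff_disjoint.mono_right hPaA⟩
      · rw [Finset.union_sdiff_of_subset hANd, ← hmarkov i y, condMass,
          div_mul_cancel₀ _ (marginalMass_pos hfull _ y).ne']
  · intro hfact i x
    have hanc := ancestral_downward_induction hacyclic
      (R := fun A => ∀ x, marginalMass P A x = ∏ j ∈ A, condMass P j (Pa j) x)
      (fun x => by rw [marginalMass_univ, hfact x]) ?_
    · have hNdanc : ∀ j ∈ Nd i, ∀ k, E k j → k ∈ Nd i := fun j hj k hk => by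
        have hij := ((hNd i j).1 hj).2
        refine (hNd i k).2 ⟨?_, fun h => hij (h.tail hk)⟩
        rintro rfl
        exact hij (.single hk)
      have hins := hanc (insert i (Nd i)) (fun j hj k hk => by
        refine Finset.mem_insert_of_mem ?_
        rcases Finset.mem_insert.1 hj with rfl | hj
        · exact hPaNd _ ((hPa _ k).2 hk)
        · exact hNdanc j hj k hk) x
      rw [Finset.prod_insert (hiNd i), ← hanc (Nd i) hNdanc x] at hins
      rw [condMass, hins, mul_div_cancel_right₀ _ (marginalMass_pos hfull _ x).ne']
    · intro A k hA hk hpa hins z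
      have hkPa : k ∉ Pa k := fun h => hk (hpa k ((hPa k k).1 h))
      rw [← sum_marginalMass_insert P hk]
      have hterm : ∀ v, marginalMass P (insert k A) (Function.update z k v)
          = condMass P k (Pa k) (Function.update z k v) * ∏ j ∈ A, condMass P j (Pa j) z := by
        intro v
        rw [hins, Finset.prod_insert hk]
        congr 1
        refine Finset.prod_congr rfl fun j hj => condMass_update P (fun h => hk ?_) z v
        rcases Finset.mem_insert.1 h with rfl | h
        · exact hj
        · exact hA j hj k ((hPa j k).1 h)
      simp only [hterm]
      rw [← Finset.sum_mul, sum_condMass hfull hkPa, one_mul]
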